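/- Let (Ω,ℱ,(ℱ_t),ℚ) be a filtered probability space, r, y : [0,T] × Ω → ℝ bounded progressively measurable processes, and h : [0,T] × Ω → ℝ a continuous adapted process with h(T) integrable. Suppose the process X(t) = e^{−∫_0^t r(s)ds} h(t) + ∫_0^t e^{−∫_0^s r(u)du} y(s) h(s) ds is a ℚ-martingale. Then the process h(t) e^{−∫_0^t (r(s)−y(s))ds} is a ℚ-martingale; equivalently, h(t) = E[ e^{−∫_t^T (r(s)−y(s))ds} h(T) | ℱ_t ] for all t ∈ [0,T]. -/

import Mathlib

open MeasureTheory

lemma aux_intInt {f : ℝ → ℝ} (hf : Measurable f) {C : ℝ} (hC : ∀ s, |f s| ≤ C) {g : ℝ → ℝ}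
    (hg : Continuous g) (a b : ℝ) : IntervalIntegrable (fun s => f s * g s) volume a b := by
  have h1 : IntervalIntegrable (fun _ : ℝ => C) volume a b := by simp
  have h2 : IntervalIntegrable f volume a b :=
    h1.mono_fun hf.aestronglyMeasurable (Filter.Eventually.of_forall fun s => by
      simpa using (hC s).trans (le_abs_self C))
  exact h2.mul_continuousOn hg.continuousOn

lemma aux_intInt1 {f : ℝ → ℝ} (hf : Measurable f) {C : ℝ} (hC : ∀ s, |f s| ≤ C) 
    (a b : ℝ) : IntervalIntegrable f volume a b := by
  simpa using aux_intInt hf hC (g := fun _ => 1) continuous_const a b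

lemma aux_cont {f : ℝ → ℝ} (hf : Measurable f) {C : ℝ} (hC : ∀ s, |f s| ≤ C) :
    Continuous (fun t => ∫ s in (0:ℝ)..t, f s) :=
  intervalIntegral.continuous_primitive (fun a b => aux_intInt1 hf hC a b) 0

lemma aux_bound {f : ℝ → ℝ} {C : ℝ} (hC : ∀ s, |f s| ≤ C) {t T : ℝ} (h0 : 0 ≤ t) (hT : t ≤ T) :
    |∫ s in (0:ℝ)..t, f s| ≤ C * T := by
  have := intervalIntegral.norm_integral_le_of_norm_le_const (a := 0) (b := t) (f := f) (C := C)
    (fun s _ => hC s)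
  have hC0 : 0 ≤ C := (abs_nonneg _).trans (hC 0)
  rw [sub_zero, abs_of_nonneg h0] at this
  exact this.trans (mul_le_mul_of_nonneg_left hT hC0)

lemma aux_exp_ac {f : ℝ → ℝ} (hf : Measurable f) {C : ℝ} (hC : ∀ s, |f s| ≤ C) (t : ℝ) :
    AbsolutelyContinuousOnInterval (fun x => Real.exp (∫ s in (0:ℝ)..x, f s)) 0 t := by
  have hC0 : 0 ≤ C := (abs_nonneg _).trans (hC 0)
  have hF : LipschitzWith ⟨C, hC0⟩ (fun x => ∫ s in (0:ℝ)..x, f s) := by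
    refine LipschitzWith.of_dist_le_mul fun x z => ?_
    rw [Real.dist_eq, Real.dist_eq, intervalIntegral.integral_interval_sub_left
      (aux_intInt1 hf hC _ _) (aux_intInt1 hf hC _ _)]
    exact intervalIntegral.norm_integral_le_of_norm_le_const (f := f) (fun s _ => hC s)
  obtain ⟨K, hK⟩ : ∃ K, ∀ x ∈ Set.uIcc 0 t, |∫ s in (0:ℝ)..x, f s| ≤ K :=
    isCompact_uIcc.exists_bound_of_continuousOn (aux_cont hf hC).continuousOn
  obtain ⟨L, hL⟩ := (Real.contDiff_exp (n := 1)).contDiffOn.exists_lipschitzOnWith (s := Set.Icc (-K) K)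
    (by decide) (convex_Icc _ _) isCompact_Icc
  exact (hL.comp (hF.lipschitzOnWith (s := Set.uIcc 0 t))
    (fun x hx => abs_le.1 (hK x hx))).absolutelyContinuousOnInterval

lemma aux_exp_deriv {f : ℝ → ℝ} (hf : Measurable f) {C : ℝ} (hC : ∀ s, |f s| ≤ C) (t : ℝ) :
    ∀ᵐ x, x ∈ Set.uIcc 0 t → HasDerivAt (fun x => Real.exp (∫ s in (0:ℝ)..x, f s)) 
      (f x * Real.exp (∫ s in (0:ℝ)..x, f s)) x := by
  filter_upwards [(aux_intInt1 hf hC 0 t).ae_hasDerivAt_integral] with x hx hxt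
  have := (hx hxt 0 (by simp)).exp
  rwa [mul_comm] at this

lemma aux_exp_eq {f : ℝ → ℝ} (hf : Measurable f) {C : ℝ} (hC : ∀ s, |f s| ≤ C) (t : ℝ) :
    ∫ x in (0:ℝ)..t, f x * Real.exp (∫ s in (0:ℝ)..x, f s)
      = Real.exp (∫ s in (0:ℝ)..t, f s) - 1 := by
  have := (aux_exp_ac hf hC t).integral_deriv_eq_sub
  simp only [intervalIntegral.integral_same, Real.exp_zero] at this
  rw [← this]
  apply intervalIntegral.integral_congr_ae
  filter_upwards [aux_exp_deriv hf hC t] with x hx hxt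
  exact (hx (Set.uIoc_subset_uIcc hxt)).deriv.symm

lemma aux_prod_eq {f : ℝ → ℝ} (hf : Measurable f) {C : ℝ} (hC : ∀ s, |f s| ≤ C) {Y : ℝ → ℝ}
    (hY : Continuous Y) (t : ℝ) :
    ∫ x in (0:ℝ)..t, (f x * Real.exp (∫ s in (0:ℝ)..x, f s)) * (Y x + ∫ s in (0:ℝ)..x, f s * Y s)
      = Real.exp (∫ s in (0:ℝ)..t, f s) * ∫ s in (0:ℝ)..t, f s * Y s := by
  have hi := aux_intInt hf hC hY 0 t
  have := (aux_exp_ac hf hC t).integral_deriv_mul_eq_sub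
    (hi.absolutelyContinuousOnInterval_intervalIntegral (c := 0) (by simp))
  simp only [intervalIntegral.integral_same, mul_zero, sub_zero] at this
  rw [← this]
  apply intervalIntegral.integral_congr_ae
  filter_upwards [aux_exp_deriv hf hC t, hi.ae_hasDerivAt_integral] with x hx hx2 hxt
  have hxt := Set.uIoc_subset_uIcc hxt
  rw [(hx hxt).deriv, (hx2 hxt 0 (by simp)).deriv]
  ring

section
variable {Ω : Type*} {m0 : MeasurableSpace Ω}

lemma aux_trunc {ℱ : Filtration ℝ m0} {u : ℝ → Ω → ℝ} (hu : IsStronglyProgressive ℱ u) (t : ℝ) :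
    StronglyMeasurable[MeasurableSpace.prod inferInstance (ℱ t)]
      (fun p : ℝ × Ω => u (min p.1 t) p.2) := by
  have h2 : @Measurable _ _ (MeasurableSpace.prod inferInstance (ℱ t))
      (MeasurableSpace.prod inferInstance (ℱ t))
      (fun p : ℝ × Ω => ((⟨min p.1 t, Set.mem_Iic.2 (min_le_right _ _)⟩ : Set.Iic t), p.2)) := by
    let _ := ℱ t
    fun_prop
  exact (hu t).comp_measurable h2

lemma aux_joint {ℱ : Filtration ℝ m0} {u : ℝ → Ω → ℝ} (hu : IsStronglyProgressive ℱ u) :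
    StronglyMeasurable (Function.uncurry u) := by
  refine stronglyMeasurable_of_tendsto (u := Filter.atTop) 
    (f := fun (n : ℕ) (p : ℝ × Ω) => u (min p.1 n) p.2) (fun n => ?_) ?_
  · refine (aux_trunc hu n).mono ?_
    exact sup_le_sup le_rfl (MeasurableSpace.comap_mono (ℱ.le _))
  · rw [tendsto_pi_nhds]
    rintro ⟨s, ω⟩
    refine tendsto_const_nhds.congr' ?_
    obtain ⟨N, hN⟩ := exists_nat_ge s
    filter_upwards [Filter.eventually_ge_atTop N] with n hn
    have : s ≤ n := hN.trans (by exact_mod_cast hn)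
    simp [min_eq_left this]

lemma aux_int_meas [mΩ : MeasurableSpace Ω] {f : ℝ → Ω → ℝ} (hf : StronglyMeasurable (Function.uncurry f)) (t : ℝ) :
    StronglyMeasurable (fun ω => ∫ s in (0:ℝ)..t, f s ω) := by
  simp only [intervalIntegral]
  exact hf.integral_prod_left.sub hf.integral_prod_left

lemma aux_int_adapted {ℱ : Filtration ℝ m0} {u : ℝ → Ω → ℝ} (hu : IsStronglyProgressive ℱ u)
    {t : ℝ} (ht : 0 ≤ t) : StronglyMeasurable[ℱ t] (fun ω => ∫ s in (0:ℝ)..t, u s ω) := by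
  have h1 := @aux_int_meas Ω (ℱ t) (fun s ω => u (min s t) ω) (aux_trunc hu t) t
  convert h1 using 2 with ω
  apply intervalIntegral.integral_congr
  intro s hs
  rw [Set.uIcc_of_le ht] at hs
  simp [min_eq_left hs.2]

lemma aux_core (ℱ : Filtration ℝ m0) (μ : Measure Ω) [IsProbabilityMeasure μ]
    {s t K : ℝ} (hst : s ≤ t) {β X : ℝ → Ω → ℝ} 
    (hβ : StronglyMeasurable (Function.uncurry β)) (hX : StronglyMeasurable (Function.uncurry X))
    (hβa : ∀ u ∈ Set.Icc s t, StronglyMeasurable[ℱ u] (β u))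
    (hβb : ∀ u ∈ Set.Icc s t, ∀ ω, |β u ω| ≤ K)
    (hXi : ∀ u ∈ Set.Icc s t, Integrable (X u) μ)
    (hXm : ∀ u ∈ Set.Icc s t, μ[X t | ℱ u] =ᵐ[μ] X u) :
    Integrable (fun ω => ∫ u in s..t, β u ω * X u ω) μ ∧
    Integrable (fun ω => ∫ u in s..t, β u ω * X t ω) μ ∧
    ∀ A, MeasurableSet[ℱ s] A → ∫ ω in A, (∫ u in s..t, β u ω * X u ω) ∂μ
      = ∫ ω in A, (∫ u in s..t, β u ω * X t ω) ∂μ := by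
  have hXt : StronglyMeasurable (X t) := hX.comp_measurable (measurable_prodMk_left (x := t))
  have hβu (u) : StronglyMeasurable (β u) := hβ.comp_measurable (measurable_prodMk_left (x := u))
  have hZm : StronglyMeasurable (fun p : ℝ × Ω => β p.1 p.2 * X p.1 p.2) := hβ.mul hX
  have hGm : StronglyMeasurable (fun p : ℝ × Ω => β p.1 p.2 * X t p.2) :=
    hβ.mul (hXt.comp_measurable measurable_snd)
  have hmul (u) (hu : u ∈ Set.Icc s t) (v) (hv : v ∈ Set.Icc s t) :
      Integrable (fun ω => β u ω * X v ω) μ :=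
    (hXi v hv).bdd_mul (hβu u).aestronglyMeasurable (Filter.Eventually.of_forall (hβb u hu))
  have hK : 0 ≤ K ∨ IsEmpty Ω := by
    rcases isEmpty_or_nonempty Ω with h | ⟨⟨ω⟩⟩
    · exact Or.inr h
    · exact Or.inl ((abs_nonneg _).trans (hβb s ⟨le_rfl, hst⟩ ω))
  have hcontr (u) (hu : u ∈ Set.Icc s t) : ∫ ω, |X u ω| ∂μ ≤ ∫ ω, |X t ω| ∂μ := by
    calc ∫ ω, |X u ω| ∂μ = ∫ ω, |(μ[X t | ℱ u]) ω| ∂μ := by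
          apply integral_congr_ae
          filter_upwards [hXm u hu] with ω hω
          rw [hω]
      _ ≤ _ := integral_abs_condExp_le _
  have hprod (W : ℝ → Ω → ℝ) 
      (hWm : StronglyMeasurable (fun p : ℝ × Ω => β p.1 p.2 * W p.1 p.2))
      (hW : ∀ u ∈ Set.Icc s t, Integrable (W u) μ)
      (hW' : ∀ u ∈ Set.Icc s t, Integrable (fun ω => β u ω * W u ω) μ)
      (hWb : ∀ u ∈ Set.Icc s t, ∫ ω, |W u ω| ∂μ ≤ ∫ ω, |X t ω| ∂μ) :
      Integrable (fun p : ℝ × Ω => β p.1 p.2 * W p.1 p.2) 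
        ((volume.restrict (Set.Ioc s t)).prod μ) := by
    rw [integrable_prod_iff hWm.aestronglyMeasurable]
    constructor
    · filter_upwards [ae_restrict_mem measurableSet_Ioc] with u hu
      exact hW' u (Set.Ioc_subset_Icc_self hu)
    · refine Measure.integrableOn_of_bounded (M := K * ∫ ω, |X t ω| ∂μ) (by simp) 
        hWm.norm.integral_prod_right.aestronglyMeasurable ?_
      filter_upwards [ae_restrict_mem measurableSet_Ioc] with u hu
      have hu := Set.Ioc_subset_Icc_self hu
      rw [Real.norm_of_nonneg (by positivity)]
      rcases hK with hK | hK
      · calc _ ≤ ∫ ω, K * |W u ω| ∂μ := by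
              apply integral_mono (hW' u hu).norm ((hW u hu).abs.const_mul K)
              intro ω
              simp only [norm_mul, Real.norm_eq_abs]
              exact mul_le_mul_of_nonneg_right (hβb u hu ω) (abs_nonneg _)
          _ = K * ∫ ω, |W u ω| ∂μ := integral_const_mul _ _
          _ ≤ _ := mul_le_mul_of_nonneg_left (hWb u hu) hK
      · simp [Measure.eq_zero_of_isEmpty]
  have ht : t ∈ Set.Icc s t := ⟨hst, le_rfl⟩
  have hZ := hprod X hZm hXi (fun u hu => hmul u hu u hu) hcontr
  have hG := hprod (fun _ => X t) hGm (fun _ _ => hXi t ht) (fun u hu => hmul u hu t ht) 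
    (fun _ _ => le_rfl)
  simp only [intervalIntegral.integral_of_le hst]
  refine ⟨hZ.integral_prod_right, hG.integral_prod_right, fun A hA => ?_⟩
  have hA0 : MeasurableSet A := ℱ.le _ _ hA
  have hle : (volume.restrict (Set.Ioc s t)).prod (μ.restrict A) 
      ≤ (volume.restrict (Set.Ioc s t)).prod μ := by
    exact Measure.prod_mono le_rfl Measure.restrict_le_self
  rw [← integral_integral_swap (f := fun u ω => β u ω * X u ω) (hZ.mono_measure hle),
    ← integral_integral_swap (f := fun u ω => β u ω * X t ω) (hG.mono_measure hle)]
  refine setIntegral_congr_fun measurableSet_Ioc fun u hu => ?_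
  have hu := Set.Ioc_subset_Icc_self hu
  have hAu : MeasurableSet[ℱ u] A := ℱ.mono hu.1 _ hA
  change ∫ ω in A, β u ω * X u ω ∂μ = ∫ ω in A, β u ω * X t ω ∂μ
  rw [← setIntegral_condExp (ℱ.le u) (hmul u hu t ht) hAu]
  apply setIntegral_congr_ae hA0
  filter_upwards [condExp_mul_of_stronglyMeasurable_left (hβa u hu) (hmul u hu t ht) (hXi t ht),
    hXm u hu] with ω h1 h2 _
  change _ = (μ[β u * X t | ℱ u]) ω
  rw [h1, Pi.mul_apply, h2]
end

/-- If the discounted price plus the accumulated collateral-dividend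
stream is a martingale, then the price discounted at the effective rate `r - y` is a
martingale; equivalently `h(t) = E[exp(-∫_t^T (r-y)) h(T) | ℱ_t]`. -/
theorem collateralized_effective_discounting
    {Ω : Type*} {m0 : MeasurableSpace Ω}
    (ℱ : Filtration ℝ m0) (μ : Measure Ω) [IsProbabilityMeasure μ]
    (T : ℝ) (hT : 0 < T)
    (r y : ℝ → Ω → ℝ)
    (hr_prog : ProgMeasurable ℱ r) (hy_prog : ProgMeasurable ℱ y)
    (Cr : ℝ) (hr_bdd : ∀ t ω, |r t ω| ≤ Cr)
    (Cy : ℝ) (hy_bdd : ∀ t ω, |y t ω| ≤ Cy)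
    (h : ℝ → Ω → ℝ)
    (hh_adapted : Adapted ℱ h)
    (hh_cont : ∀ ω, Continuous fun t => h t ω)
    (hhT_int : Integrable (h T) μ)
    (X : ℝ → Ω → ℝ)
    (hX : ∀ t ω, X t ω
      = Real.exp (-∫ s in (0:ℝ)..t, r s ω) * h t ω
        + ∫ s in (0:ℝ)..t, Real.exp (-∫ u in (0:ℝ)..s, r u ω) * y s ω * h s ω)
    (hX_int : ∀ t ∈ Set.Icc (0:ℝ) T, Integrable (X t) μ)
    (hX_mart : ∀ s t, 0 ≤ s → s ≤ t → t ≤ T → μ[X t | ℱ s] =ᵐ[μ] X s)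
    (M : ℝ → Ω → ℝ)
    (hM : ∀ t ω, M t ω = h t ω * Real.exp (-∫ s in (0:ℝ)..t, (r s ω - y s ω))) :
    (∀ s t, 0 ≤ s → s ≤ t → t ≤ T → μ[M t | ℱ s] =ᵐ[μ] M s)
    ∧ (∀ t ∈ Set.Icc (0:ℝ) T,
        (fun ω => h t ω)
          =ᵐ[μ] μ[fun ω => Real.exp (-∫ s in t..T, (r s ω - y s ω)) * h T ω | ℱ t]) := by
  have hym := aux_joint hy_prog
  have hrm := aux_joint hr_prog
  have hyω (ω) : Measurable fun s => y s ω :=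
    hym.measurable.comp (measurable_prodMk_right (y := ω))
  have hrω (ω) : Measurable fun s => r s ω :=
    hrm.measurable.comp (measurable_prodMk_right (y := ω))
  set B : ℝ → Ω → ℝ := fun t ω => Real.exp (∫ s in (0:ℝ)..t, y s ω) with hB
  set Y : ℝ → Ω → ℝ := fun t ω => Real.exp (-∫ s in (0:ℝ)..t, r s ω) * h t ω with hY
  have hYc (ω) : Continuous fun t => Y t ω :=
    (Real.continuous_exp.comp (aux_cont (hrω ω) (fun s => hr_bdd s ω)).neg).mul (hh_cont ω)
  have hBc (ω) : Continuous fun t => B t ω :=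
    Real.continuous_exp.comp (aux_cont (hyω ω) (fun s => hy_bdd s ω))
  have hh_m (t) : Measurable (h t) := (hh_adapted t).mono (ℱ.le t) le_rfl
  have hYm (t) : StronglyMeasurable (Y t) :=
    (Real.continuous_exp.comp_stronglyMeasurable (aux_int_meas hrm t).neg).mul
      (hh_m t).stronglyMeasurable
  have hBm (t) : StronglyMeasurable (B t) :=
    Real.continuous_exp.comp_stronglyMeasurable (aux_int_meas hym t)
  have hYj : StronglyMeasurable (Function.uncurry Y) :=
    stronglyMeasurable_uncurry_of_continuous_of_stronglyMeasurable hYc hYm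
  have hBj : StronglyMeasurable (Function.uncurry B) :=
    stronglyMeasurable_uncurry_of_continuous_of_stronglyMeasurable hBc hBm
  have hX' (t ω) : X t ω = Y t ω + ∫ s in (0:ℝ)..t, y s ω * Y s ω := by
    rw [hX]
    congr 1
    refine intervalIntegral.integral_congr fun s _ => ?_
    simp only [hY]
    ring
  have hXc (ω) : Continuous fun t => X t ω := by
    simp only [hX']
    exact (hYc ω).add (intervalIntegral.continuous_primitive
      (fun a b => aux_intInt (hyω ω) (fun s => hy_bdd s ω) (hYc ω) a b) 0)
  have hXm (t) : StronglyMeasurable (X t) := by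
    have : X t = fun ω => Y t ω + ∫ s in (0:ℝ)..t, y s ω * Y s ω := funext (hX' t)
    rw [this]
    exact (hYm t).add (aux_int_meas (f := fun s ω => y s ω * Y s ω) (hym.mul hYj) t)
  have hXj : StronglyMeasurable (Function.uncurry X) :=
    stronglyMeasurable_uncurry_of_continuous_of_stronglyMeasurable hXc hXm
  have hsub (a b ω) : ∫ s in a..b, (r s ω - y s ω)
      = (∫ s in a..b, r s ω) - ∫ s in a..b, y s ω :=
    intervalIntegral.integral_sub (aux_intInt1 (hrω ω) (fun s => hr_bdd s ω) a b)
      (aux_intInt1 (hyω ω) (fun s => hy_bdd s ω) a b)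
  have hMY (t ω) : M t ω = B t ω * Y t ω := by
    rw [hM, hsub, neg_sub, sub_eq_add_neg, Real.exp_add]
    simp only [hB, hY]
    ring
  set β : ℝ → Ω → ℝ := fun t ω => y t ω * B t ω with hβ
  have hMX (t ω) : M t ω = B t ω * X t ω - ∫ u in (0:ℝ)..t, β u ω * X u ω := by
    have := aux_prod_eq (hyω ω) (fun s => hy_bdd s ω) (hYc ω) t
    simp only [hX', hβ, hB] at this ⊢
    rw [this, hMY]
    ring
  have hβint (a b ω) : IntervalIntegrable (fun u => β u ω) volume a b :=
    aux_intInt (hyω ω) (fun s => hy_bdd s ω) (hBc ω) a b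
  have hβXint (a b ω) : IntervalIntegrable (fun u => β u ω * X u ω) volume a b :=
    (hβint a b ω).mul_continuousOn (hXc ω).continuousOn
  have hBβ (s t ω) : ∫ u in s..t, β u ω = B t ω - B s ω := by
    rw [← intervalIntegral.integral_interval_sub_left (hβint 0 t ω) (hβint 0 s ω)]
    have h1 := aux_exp_eq (hyω ω) (fun s => hy_bdd s ω) t
    have h2 := aux_exp_eq (hyω ω) (fun s => hy_bdd s ω) s
    simp only [hβ, hB]
    rw [h1, h2]
    ring
  have hBb (t) (ht : t ∈ Set.Icc 0 T) (ω) : |B t ω| ≤ Real.exp (Cy * T) := by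
    rw [abs_of_pos (Real.exp_pos _)]
    exact Real.exp_le_exp.2 ((le_abs_self _).trans (aux_bound (fun s => hy_bdd s ω) ht.1 ht.2))
  have hβb (t) (ht : t ∈ Set.Icc 0 T) (ω) : |β t ω| ≤ Cy * Real.exp (Cy * T) := by
    rw [abs_mul]
    exact mul_le_mul (hy_bdd t ω) (hBb t ht ω) (abs_nonneg _) ((abs_nonneg _).trans (hy_bdd t ω))
  have hBa (t) (ht : 0 ≤ t) : StronglyMeasurable[ℱ t] (B t) :=
    Real.continuous_exp.comp_stronglyMeasurable (aux_int_adapted hy_prog ht)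
  have hβa (t) (ht : 0 ≤ t) : StronglyMeasurable[ℱ t] (β t) :=
    (IsStronglyProgressive.stronglyAdapted hy_prog t).mul (hBa t ht)
  have hMa (t) (ht : 0 ≤ t) : StronglyMeasurable[ℱ t] (M t) := by
    have : M t = fun ω => B t ω * (Real.exp (-∫ s in (0:ℝ)..t, r s ω) * h t ω) :=
      funext (hMY t)
    rw [this]
    exact (hBa t ht).mul ((Real.continuous_exp.comp_stronglyMeasurable
      (aux_int_adapted hr_prog ht).neg).mul (hh_adapted t).stronglyMeasurable)
  have hcore (s t) (hs : 0 ≤ s) (hst : s ≤ t) (htT : t ≤ T) :=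
    aux_core ℱ μ (K := Cy * Real.exp (Cy * T)) hst (β := β) (X := X) (hym.mul hBj) hXj
      (fun u hu => hβa u (hs.trans hu.1)) (fun u hu => hβb u ⟨hs.trans hu.1, hu.2.trans htT⟩)
      (fun u hu => hX_int u ⟨hs.trans hu.1, hu.2.trans htT⟩)
      (fun u hu => hX_mart u t (hs.trans hu.1) hu.2 htT)
  have hBX (s t) (hs : s ∈ Set.Icc 0 T) (ht : t ∈ Set.Icc 0 T) :
      Integrable (fun ω => B s ω * X t ω) μ :=
    (hX_int t ht).bdd_mul (hBm s).aestronglyMeasurable (Filter.Eventually.of_forall (hBb s hs))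
  have hMi (t) (ht : t ∈ Set.Icc 0 T) : Integrable (M t) μ := by
    have : M t = fun ω => B t ω * X t ω - ∫ u in (0:ℝ)..t, β u ω * X u ω := funext (hMX t)
    rw [this]
    exact (hBX t t ht ht).sub (hcore 0 t le_rfl ht.1 ht.2).1
  have hmart : ∀ s t, 0 ≤ s → s ≤ t → t ≤ T → μ[M t | ℱ s] =ᵐ[μ] M s := by
    intro s t hs hst htT
    have hsI : s ∈ Set.Icc 0 T := ⟨hs, hst.trans htT⟩
    have htI : t ∈ Set.Icc 0 T := ⟨hs.trans hst, htT⟩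
    obtain ⟨i1, i2, hsw⟩ := hcore s t hs hst htT
    symm
    refine ae_eq_condExp_of_forall_setIntegral_eq (ℱ.le s) (hMi t htI)
      (fun _ _ _ => (hMi s hsI).integrableOn) (fun A hA _ => ?_) (hMa s hs).aestronglyMeasurable
    have hA0 : MeasurableSet A := ℱ.le _ _ hA
    have key : ∀ ω, M t ω - M s ω = B t ω * X t ω - B s ω * X s ω
        - ∫ u in s..t, β u ω * X u ω := by
      intro ω
      rw [hMX, hMX, ← intervalIntegral.integral_interval_sub_left (hβXint 0 t ω) (hβXint 0 s ω)]
      ring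
    have hG : ∀ ω, ∫ u in s..t, β u ω * X t ω = B t ω * X t ω - B s ω * X t ω := by
      intro ω
      rw [intervalIntegral.integral_mul_const, hBβ]
      ring
    have hsw := hsw A hA
    simp only [hG] at hsw
    rw [integral_sub (hBX t t htI htI).integrableOn (hBX s t hsI htI).integrableOn] at hsw
    have h1 : ∫ ω in A, M t ω ∂μ - ∫ ω in A, M s ω ∂μ
        = ∫ ω in A, B t ω * X t ω ∂μ - ∫ ω in A, B s ω * X s ω ∂μ
          - ∫ ω in A, (∫ u in s..t, β u ω * X u ω) ∂μ := by
      rw [← integral_sub (hMi t htI).integrableOn (hMi s hsI).integrableOn,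
        ← integral_sub (hBX t t htI htI).integrableOn (hBX s s hsI hsI).integrableOn,
        ← integral_sub (f := fun ω => B t ω * X t ω - B s ω * X s ω)
          ((hBX t t htI htI).sub (hBX s s hsI hsI)).integrableOn i1.integrableOn]
      exact integral_congr_ae (Filter.Eventually.of_forall key)
    have h2 : ∫ ω in A, B s ω * X s ω ∂μ = ∫ ω in A, B s ω * X t ω ∂μ := by
      rw [← setIntegral_condExp (ℱ.le s) (hBX s t hsI htI) hA]
      apply setIntegral_congr_ae hA0
      filter_upwards [condExp_mul_of_stronglyMeasurable_left (hBa s hs) (hBX s t hsI htI)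
        (hX_int t htI), hX_mart s t hs hst htT] with ω h1 h2 _
      change _ = (μ[B s * X t | ℱ s]) ω
      rw [h1, Pi.mul_apply, h2]
    linarith
  refine ⟨hmart, fun t ht => ?_⟩
  have hTI : T ∈ Set.Icc 0 T := ⟨hT.le, le_rfl⟩
  set E : Ω → ℝ := fun ω => Real.exp (∫ s in (0:ℝ)..t, (r s ω - y s ω)) with hE
  have hEa : StronglyMeasurable[ℱ t] E := by
    simp only [hE, hsub]
    exact Real.continuous_exp.comp_stronglyMeasurable
      ((aux_int_adapted hr_prog ht.1).sub (aux_int_adapted hy_prog ht.1))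
  have hEb (ω) : |E ω| ≤ Real.exp ((Cr + Cy) * T) := by
    rw [abs_of_pos (Real.exp_pos _)]
    refine Real.exp_le_exp.2 ((le_abs_self _).trans (aux_bound (fun s => ?_) ht.1 ht.2))
    exact (abs_sub _ _).trans (add_le_add (hr_bdd s ω) (hy_bdd s ω))
  have hEM : Integrable (E * M T) μ :=
    (hMi T hTI).bdd_mul (hEa.mono (ℱ.le t)).aestronglyMeasurable
      (Filter.Eventually.of_forall hEb)
  have hfun : (fun ω => Real.exp (-∫ s in t..T, (r s ω - y s ω)) * h T ω) = E * M T := by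
    funext ω
    have hi (a b) : IntervalIntegrable (fun s => r s ω - y s ω) volume a b :=
      (aux_intInt1 (hrω ω) (fun s => hr_bdd s ω) a b).sub
        (aux_intInt1 (hyω ω) (fun s => hy_bdd s ω) a b)
    rw [Pi.mul_apply, hM, ← intervalIntegral.integral_interval_sub_left (hi 0 T) (hi 0 t),
      neg_sub, sub_eq_add_neg, Real.exp_add]
    simp only [hE]
    ring
  rw [hfun]
  filter_upwards [condExp_mul_of_stronglyMeasurable_left hEa hEM (hMi T hTI),
    hmart t T ht.1 ht.2 le_rfl] with ω h1 h2
  rw [h1, Pi.mul_apply, h2, hM, Real.exp_neg]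
  simp only [hE]
  field_simp
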